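/- Let R be a Dedekind domain with fraction field K. Let A be an associative unital R-algebra and B a left A-module such that both A and B are flat as R-modules. Then B is faithfully flat as a left A-module if and only if B ⊗_R k is faithfully flat as a left (A ⊗_R k)-module for k = K and for k = R/m for every maximal ideal m of R. -/

import Mathlib

open TensorProduct

/-- Flatness of a left module over a possibly noncommutative ring, expressed by
Lazard's equational criterion: every linear relation `∑ aᵢ • bᵢ = 0` with
coefficients in the ring trivializes. This is equivalent to exactness of the
functor `(-) ⊗_A B` on right `A`-modules. -/
def IsFlatMod (A B : Type*) [Ring A] [AddCommGroup B] [Module A B] : Prop :=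
  ∀ (n : ℕ) (a : Fin n → A) (b : Fin n → B), (∑ i, a i • b i) = 0 →
    ∃ (m : ℕ) (c : Fin n → Fin m → A) (y : Fin m → B),
      (∀ i, b i = ∑ j, c i j • y j) ∧ ∀ j, (∑ i, a i * c i j) = 0

/-- Faithful flatness of a left module `B` over a possibly noncommutative ring `A`:
`B` is flat, and `I • B ≠ B` for every proper right ideal `I` of `A`. This is
equivalent to the functor `(-) ⊗_A B` on right `A`-modules being exact and killing
only the zero module. -/
def IsFaithfullyFlatMod (A B : Type*) [Ring A] [AddCommGroup B] [Module A B] : Prop :=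
  IsFlatMod A B ∧
    ∀ I : Submodule Aᵐᵒᵖ A, I ≠ ⊤ →
      AddSubgroup.closure {x : B | ∃ a ∈ I, ∃ y : B, x = a • y} ≠ ⊤

section FiberModule

variable (R A B k : Type*) [CommRing R] [Ring A] [Algebra R A]
  [AddCommGroup B] [Module R B] [Module A B] [IsScalarTower R A B]
  [CommRing k] [Algebra R k]

instance (priority := low) smulCommClass_of_isScalarTower : SMulCommClass R A B :=
  ⟨fun r a b => by
    rw [← algebraMap_smul A r b, ← algebraMap_smul A r (a • b), ← mul_smul, ← mul_smul,
      Algebra.commutes]⟩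

/-- The action of `k` on the right tensor factor of `B ⊗[R] k`, packaged as a ring
homomorphism `End R k →+* End R (B ⊗[R] k)`. -/
noncomputable def lTensorEndHom : Module.End R k →+* Module.End R (B ⊗[R] k) where
  toFun f := LinearMap.lTensor B f
  map_zero' := LinearMap.lTensor_zero B
  map_add' := LinearMap.lTensor_add B
  map_one' := LinearMap.lTensor_id B k
  map_mul' f g := LinearMap.lTensor_comp B f g

/-- The `k`-module structure on `B ⊗[R] k` (action on the right factor). -/
noncomputable def kAction : Module k (B ⊗[R] k) :=
  Module.compHom _ ((lTensorEndHom R B k).comp (Module.toModuleEnd R k))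

/-- The natural `A ⊗[R] k`-module structure on the base change `B ⊗[R] k`:
`(a ⊗ c) • (b ⊗ d) = (a • b) ⊗ (c * d)`. -/
noncomputable def fiberModule : Module (A ⊗[R] k) (B ⊗[R] k) := by
  letI : Module k (B ⊗[R] k) := kAction R B k
  haveI h1 : ∀ (c : k) (b : B) (d : k), c • (b ⊗ₜ[R] d) = b ⊗ₜ[R] (c • d) := fun _ _ _ => rfl
  letI : SMulCommClass A k (B ⊗[R] k) := by
    constructor
    intro a c x
    induction x with
    | zero => simp
    | tmul b d => rw [h1, smul_tmul', smul_tmul', h1]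
    | add x y hx hy => simp only [smul_add, hx, hy]
  letI : IsScalarTower R k (B ⊗[R] k) := by
    constructor
    intro r c x
    induction x with
    | zero => simp
    | tmul b d => rw [h1, h1, smul_assoc, ← smul_tmul]; exact (smul_tmul' r b (c • d)).symm
    | add x y hx hy => simp only [smul_add, hx, hy]
  exact TensorProduct.Algebra.module

end FiberModule

section Relations

variable (R : Type*) [CommRing R] {A : Type*} [Ring A] [Algebra R A]
  (B : Type*) [AddCommGroup B] [Module R B] [Module A B] [IsScalarTower R A B]

/-- The vectors `b` spanned by vectors of the form `c • y` with `∑ aᵢ * cᵢ ∈ I`. -/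
def relationsMod (I : Submodule Aᵐᵒᵖ A) {n : ℕ} (a : Fin n → A) : Submodule R (Fin n → B) :=
  Submodule.span R {x | ∃ c : Fin n → A, ∑ i, a i * c i ∈ I ∧ ∃ y : B, x = fun i => c i • y}

/-- The `R`-submodule `I • B` of `B` for a right ideal `I` of `A`. -/
def rightIdealSMul (I : Submodule Aᵐᵒᵖ A) : Submodule R B :=
  Submodule.span R {x | ∃ a ∈ I, ∃ y : B, x = a • y}

variable {B}

lemma mem_relationsMod_iff {I : Submodule Aᵐᵒᵖ A} {n : ℕ} {a : Fin n → A} {b : Fin n → B} :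
    b ∈ relationsMod R B I a ↔ ∃ (m : ℕ) (c : Fin n → Fin m → A) (y : Fin m → B),
      (∀ i, b i = ∑ j, c i j • y j) ∧ ∀ j, ∑ i, a i * c i j ∈ I := by
  constructor
  · intro hb
    obtain ⟨m, f, g, rfl⟩ := (Submodule.mem_span_set' (R := R)).1 hb
    choose c hc y hy using fun j => (g j).2
    refine ⟨m, fun i j => c j i, fun j => f j • y j, fun i => ?_, hc⟩
    simp only [Finset.sum_apply, Pi.smul_apply, hy, smul_comm (f _)]
  · rintro ⟨m, c, y, hb, hc⟩
    have : b = ∑ j, fun i => c i j • y j := by ext i; simp [hb]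
    rw [this]
    exact Submodule.sum_mem _ fun j _ => Submodule.subset_span ⟨_, hc j, _, rfl⟩

lemma mem_rightIdealSMul_iff {I : Submodule Aᵐᵒᵖ A} {b : B} :
    b ∈ rightIdealSMul R B I ↔ ∃ (m : ℕ) (a : Fin m → A) (y : Fin m → B),
      (∀ j, a j ∈ I) ∧ b = ∑ j, a j • y j := by
  constructor
  · intro hb
    obtain ⟨m, f, g, rfl⟩ := (Submodule.mem_span_set' (R := R)).1 hb
    choose a ha y hy using fun j => (g j).2
    refine ⟨m, a, fun j => f j • y j, ha, ?_⟩
    simp only [hy, smul_comm (f _)]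
  · rintro ⟨m, a, y, ha, rfl⟩
    exact Submodule.sum_mem _ fun j _ => Submodule.subset_span ⟨_, ha j, _, rfl⟩

omit [Algebra R A] [IsScalarTower R A B] in
lemma smul_mem_rightIdealSMul {I : Submodule Aᵐᵒᵖ A} {a : A} (ha : a ∈ I) (y : B) :
    a • y ∈ rightIdealSMul R B I :=
  Submodule.subset_span ⟨a, ha, y, rfl⟩

lemma rightIdeal_mul_mem {I : Submodule Aᵐᵒᵖ A} {a : A} (ha : a ∈ I) (x : A) : a * x ∈ I :=
  I.smul_mem (MulOpposite.op x) ha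

lemma rightIdeal_smul_mem {I : Submodule Aᵐᵒᵖ A} (r : R) {a : A} (ha : a ∈ I) : r • a ∈ I := by
  rw [Algebra.smul_def, Algebra.commutes]
  exact rightIdeal_mul_mem ha _

lemma rightIdeal_eq_top_of_one_mem {I : Submodule Aᵐᵒᵖ A} (h : (1 : A) ∈ I) : I = ⊤ :=
  eq_top_iff.2 fun x _ => by simpa using rightIdeal_mul_mem h x

lemma isFlatMod_iff : IsFlatMod A B ↔ ∀ (n : ℕ) (a : Fin n → A) (b : Fin n → B),
    ∑ i, a i • b i = 0 → b ∈ relationsMod R B ⊥ a := by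
  simp only [mem_relationsMod_iff, Submodule.mem_bot, IsFlatMod]

lemma closure_eq_top_iff (I : Submodule Aᵐᵒᵖ A) :
    AddSubgroup.closure {x : B | ∃ a ∈ I, ∃ y : B, x = a • y} = ⊤ ↔
      rightIdealSMul R B I = ⊤ := by
  have : AddSubgroup.closure {x : B | ∃ a ∈ I, ∃ y : B, x = a • y} =
      (rightIdealSMul R B I).toAddSubgroup := by
    apply le_antisymm
    · rw [AddSubgroup.closure_le]
      exact Submodule.subset_span
    · intro x hx
      obtain ⟨m, a, y, ha, rfl⟩ := (mem_rightIdealSMul_iff R).1 hx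
      exact AddSubgroup.sum_mem _ fun j _ => AddSubgroup.subset_closure ⟨_, ha j, _, rfl⟩
  rw [this, ← Submodule.top_toAddSubgroup (R := R), Submodule.toAddSubgroup_inj]

lemma isFaithfullyFlatMod_iff : IsFaithfullyFlatMod A B ↔
    IsFlatMod A B ∧ ∀ I : Submodule Aᵐᵒᵖ A, rightIdealSMul R B I = ⊤ → I = ⊤ := by
  simp only [IsFaithfullyFlatMod, ne_eq, closure_eq_top_iff R (B := B), not_imp_not]

/-- A flat module satisfies the equational criterion modulo any right ideal. -/
lemma IsFlatMod.mem_relationsMod (h : IsFlatMod A B) (I : Submodule Aᵐᵒᵖ A) {n : ℕ}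
    {a : Fin n → A} {b : Fin n → B} (hab : ∑ i, a i • b i ∈ rightIdealSMul R B I) :
    b ∈ relationsMod R B I a := by
  obtain ⟨m, a', y, ha', hy⟩ := (mem_rightIdealSMul_iff R).1 hab
  obtain ⟨p, c, z, hz, hc⟩ := h (n + m) (Fin.append a (-a')) (Fin.append b y) (by
    simp [Fin.sum_univ_add, hy])
  refine (mem_relationsMod_iff R).2 ⟨p, fun i => c (Fin.castAdd m i), z,
    fun i => by simpa using hz (Fin.castAdd m i), fun k => ?_⟩
  have hk := hc k
  simp only [Fin.sum_univ_add, Fin.append_left, Fin.append_right, Pi.neg_apply, neg_mul,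
    Finset.sum_neg_distrib, ← sub_eq_add_neg, sub_eq_zero] at hk
  rw [hk]
  exact I.sum_mem fun j _ => rightIdeal_mul_mem (ha' j) _

/-- A flat module satisfies the equational criterion for finite systems of relations. -/
lemma IsFlatMod.exists_of_system (h : IsFlatMod A B) {m : ℕ} (y : Fin m → B) {n : ℕ}
    (c : Fin n → Fin m → A) (hc : ∀ i, ∑ j, c i j • y j = 0) :
    ∃ (p : ℕ) (d : Fin m → Fin p → A) (z : Fin p → B),
      (∀ j, y j = ∑ k, d j k • z k) ∧ ∀ i k, ∑ j, c i j * d j k = 0 := by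
  induction n with
  | zero =>
    refine ⟨m, fun j k => if j = k then 1 else 0, y, fun j => ?_, fun i => i.elim0⟩
    simp [ite_smul]
  | succ n ih =>
    obtain ⟨p, d, z, hz, hd⟩ := ih (fun i => c i.succ) fun i => hc i.succ
    obtain ⟨q, e, w, hw, he⟩ := h p (fun k => ∑ j, c 0 j * d j k) z (by
      rw [← hc 0]
      simp_rw [hz, Finset.smul_sum, Finset.sum_smul, mul_smul]
      exact Finset.sum_comm)
    have key : ∀ i l, ∑ j, c i j * ∑ k, d j k * e k l = ∑ k, (∑ j, c i j * d j k) * e k l := by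
      intro i l
      simp_rw [Finset.mul_sum, Finset.sum_mul, mul_assoc]
      exact Finset.sum_comm
    refine ⟨q, fun j l => ∑ k, d j k * e k l, w, fun j => ?_, fun i l => ?_⟩
    · rw [hz]
      simp_rw [hw, Finset.smul_sum, Finset.sum_smul, mul_smul]
      exact Finset.sum_comm
    · rw [key]
      refine Fin.cases (he l) (fun i => ?_) i
      simp [hd]

end Relations

lemma exists_smul_eq_smul_of_mem_smul_top {R N : Type*} [CommRing R] [AddCommGroup N] [Module R N]
    {m : Ideal R} {s t : R} (hst : ∀ x ∈ m, t ∣ s * x) {x : N}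
    (hx : x ∈ m • (⊤ : Submodule R N)) : ∃ w, s • x = t • w := by
  induction hx using Submodule.smul_induction_on' with
  | smul r hr x _ =>
    obtain ⟨u, hu⟩ := hst r hr
    exact ⟨u • x, by rw [smul_smul, hu, smul_smul]⟩
  | add x _ y _ hx hy =>
    obtain ⟨w, hw⟩ := hx
    obtain ⟨v, hv⟩ := hy
    exact ⟨w + v, by rw [smul_add, smul_add, hw, hv]⟩

section BaseChange

variable {R : Type*} [CommRing R] {A B : Type*} [Ring A] [Algebra R A]
  [AddCommGroup B] [Module R B] [Module A B] [IsScalarTower R A B]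
  {S M : Type*} [Ring S] [Algebra R S]
  [AddCommGroup M] [Module R M] [Module S M] [IsScalarTower R S M]
  (φ : A →ₐ[R] S) (ψ : B →ₗ[R] M)

/-- The preimage of a right ideal under an algebra homomorphism. -/
def rightIdealComap (I : Submodule Sᵐᵒᵖ S) : Submodule Aᵐᵒᵖ A where
  carrier := {a | φ a ∈ I}
  add_mem' ha hb := by simpa using I.add_mem ha hb
  zero_mem' := by simp
  smul_mem' x a ha := by simpa using rightIdeal_mul_mem ha (φ x.unop)

@[simp] lemma mem_rightIdealComap {I : Submodule Sᵐᵒᵖ S} {a : A} :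
    a ∈ rightIdealComap φ I ↔ φ a ∈ I := Iff.rfl

variable {φ ψ}

section Quotient

variable {m : Ideal R}

lemma smul_top_le_rightIdealSMul_ker (hm : ∀ r ∈ m, algebraMap R S r = 0) :
    m • (⊤ : Submodule R B) ≤ rightIdealSMul R B (rightIdealComap φ ⊥) := by
  rw [Submodule.smul_le]
  intro r hr b _
  rw [← algebraMap_smul A r b]
  exact smul_mem_rightIdealSMul R (by simp [hm r hr]) b

omit [IsScalarTower R S M] in
lemma IsFlatMod.of_quotient (h : IsFlatMod A B) (hψ : ∀ a b, ψ (a • b) = φ a • ψ b)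
    (hφs : Function.Surjective φ) (hψs : Function.Surjective ψ)
    (hm : ∀ r ∈ m, algebraMap R S r = 0)
    (hψk : ∀ b, ψ b = 0 → b ∈ m • (⊤ : Submodule R B)) : IsFlatMod S M := by
  intro n s x hx
  choose a ha using fun i => hφs (s i)
  choose b hb using fun i => hψs (x i)
  have h0 : ψ (∑ i, a i • b i) = 0 := by simpa [hψ, ha, hb] using hx
  obtain ⟨p, c, y, hy, hc⟩ := (mem_relationsMod_iff R).1
    (h.mem_relationsMod R _ (smul_top_le_rightIdealSMul_ker (φ := φ) hm (hψk _ h0)))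
  refine ⟨p, fun i j => φ (c i j), fun j => ψ (y j), fun i => ?_, fun j => ?_⟩
  · simp [← hb, hy, hψ]
  · simpa [ha] using hc j

lemma IsFaithfullyFlatMod.of_quotient (h : IsFaithfullyFlatMod A B)
    (hψ : ∀ a b, ψ (a • b) = φ a • ψ b)
    (hφs : Function.Surjective φ) (hψs : Function.Surjective ψ)
    (hm : ∀ r ∈ m, algebraMap R S r = 0)
    (hψk : ∀ b, ψ b = 0 → b ∈ m • (⊤ : Submodule R B)) : IsFaithfullyFlatMod S M := by
  rw [isFaithfullyFlatMod_iff R] at h ⊢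
  refine ⟨h.1.of_quotient hψ hφs hψs hm hψk, fun I hI => ?_⟩
  have hle : rightIdealSMul R M I ≤ (rightIdealSMul R B (rightIdealComap φ I)).map ψ := by
    refine Submodule.span_le.2 ?_
    rintro _ ⟨s, hs, x, rfl⟩
    obtain ⟨a, rfl⟩ := hφs s
    obtain ⟨b, rfl⟩ := hψs x
    exact ⟨a • b, smul_mem_rightIdealSMul R (I := rightIdealComap φ I) hs b, hψ a b⟩
  have htop : rightIdealSMul R B (rightIdealComap φ I) = ⊤ := by
    refine eq_top_iff.2 fun b _ => ?_
    obtain ⟨b', hb', hbb'⟩ := hle (hI ▸ Submodule.mem_top : ψ b ∈ _)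
    have hk := smul_top_le_rightIdealSMul_ker (B := B) (φ := φ) hm (hψk (b - b') (by simp [hbb']))
    have hmono : rightIdealSMul R B (rightIdealComap φ ⊥) ≤
        rightIdealSMul R B (rightIdealComap φ I) := by
      refine Submodule.span_mono ?_
      rintro _ ⟨a, ha, y, rfl⟩
      exact ⟨a, (bot_le : (⊥ : Submodule Sᵐᵒᵖ S) ≤ I) ha, y, rfl⟩
    simpa using add_mem (hmono hk) hb'
  have h1 : (1 : A) ∈ rightIdealComap φ I := by simp [h.2 _ htop]
  exact rightIdeal_eq_top_of_one_mem (by simpa using h1)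

omit [IsScalarTower R A B] [IsScalarTower R S M] in
lemma exists_mem_sub_mem_smul_top (hMS : ∀ I : Submodule Sᵐᵒᵖ S, rightIdealSMul R M I = ⊤ → I = ⊤)
    (hψ : ∀ a b, ψ (a • b) = φ a • ψ b)
    (hφs : Function.Surjective φ) (hψs : Function.Surjective ψ)
    (hφk : ∀ a, φ a = 0 → a ∈ m • (⊤ : Submodule R A))
    {I : Submodule Aᵐᵒᵖ A} (hI : rightIdealSMul R B I = ⊤) :
    ∃ a ∈ I, 1 - a ∈ m • (⊤ : Submodule R A) := by
  let J : Submodule Sᵐᵒᵖ S :=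
    { carrier := {s | ∃ a ∈ I, φ a = s}
      add_mem' := by
        rintro _ _ ⟨a, ha, rfl⟩ ⟨b, hb, rfl⟩
        exact ⟨a + b, I.add_mem ha hb, by simp⟩
      zero_mem' := ⟨0, I.zero_mem, by simp⟩
      smul_mem' := by
        rintro s _ ⟨a, ha, rfl⟩
        obtain ⟨x, hx⟩ := hφs s.unop
        exact ⟨a * x, rightIdeal_mul_mem ha x, by simp [hx]⟩ }
  have hle : (rightIdealSMul R B I).map ψ ≤ rightIdealSMul R M J := by
    rw [Submodule.map_le_iff_le_comap]
    refine Submodule.span_le.2 ?_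
    rintro _ ⟨a, ha, y, rfl⟩
    simp only [Submodule.comap_coe, Set.mem_preimage, hψ]
    exact smul_mem_rightIdealSMul R (I := J) ⟨a, ha, rfl⟩ _
  have hJ : J = ⊤ := hMS J (by
    rw [hI, Submodule.map_top, LinearMap.range_eq_top.2 hψs] at hle
    exact top_le_iff.1 hle)
  obtain ⟨a, ha, h1⟩ : (1 : S) ∈ J := hJ ▸ Submodule.mem_top
  exact ⟨a, ha, hφk _ (by simp [h1])⟩

lemma smul_mem_relationsMod_of_quotient [Module.IsTorsionFree R A] [Module.IsTorsionFree R B]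
    [IsDomain R] (h : IsFlatMod S M)
    (hψ : ∀ a b, ψ (a • b) = φ a • ψ b)
    (hφs : Function.Surjective φ) (hψs : Function.Surjective ψ)
    (hm : ∀ r ∈ m, algebraMap R S r = 0)
    (hφk : ∀ a, φ a = 0 → a ∈ m • (⊤ : Submodule R A))
    (hψk : ∀ b, ψ b = 0 → b ∈ m • (⊤ : Submodule R B))
    {s t : R} (htm : t ∈ m) (ht : t ≠ 0) (hst : ∀ x ∈ m, t ∣ s * x)
    {n : ℕ} {a : Fin n → A} {b : Fin n → B} (hb : t • b ∈ relationsMod R B ⊥ a) :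
    s • b ∈ relationsMod R B ⊥ a := by
  obtain ⟨p, c, y, hy, hc⟩ := (mem_relationsMod_iff R).1 hb
  simp only [Submodule.mem_bot] at hc
  have hψt : ∀ x : B, ψ (t • x) = 0 := fun x => by
    rw [map_smul, ← algebraMap_smul S, hm t htm, zero_smul]
  obtain ⟨q, d', z', hz', hd'⟩ := h.exists_of_system (fun j => ψ (y j)) (fun i j => φ (c i j))
    fun i => by simpa [hψ, hψt] using congrArg ψ (hy i).symm
  choose d hd using fun j k => hφs (d' j k)
  choose z hz using fun k => hψs (z' k)
  choose w hw using fun j => exists_smul_eq_smul_of_mem_smul_top hst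
    (hψk (y j - ∑ k, d j k • z k) (by simp [hψ, hd, hz, hz']))
  choose e he using fun i k => exists_smul_eq_smul_of_mem_smul_top hst
    (hφk (∑ j, c i j * d j k) (by simp [hd, hd']))
  have hsb : s • b = ∑ k, (fun i => e i k • z k) + ∑ j, fun i => c i j • w j := by
    ext i
    refine smul_right_injective B ht ?_
    have hyj : ∀ j, s • y j = t • w j + ∑ k, s • d j k • z k := fun j => by
      rw [← hw, smul_sub, Finset.smul_sum, sub_add_cancel]
    have hbi : t • b i = ∑ j, c i j • y j := hy i
    simp only [Pi.smul_apply, Pi.add_apply, Finset.sum_apply]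
    rw [smul_comm, hbi, Finset.smul_sum, smul_add, Finset.smul_sum, Finset.smul_sum]
    simp_rw [← smul_comm (c _ _) s, hyj, smul_add, Finset.sum_add_distrib, ← smul_assoc t, ← he,
      smul_comm (c _ _) t, Finset.smul_sum, Finset.sum_smul]
    rw [add_comm, Finset.sum_comm]
    simp only [smul_assoc, mul_smul, smul_comm (c _ _) s]
  rw [hsb]
  refine add_mem (Submodule.sum_mem _ fun k _ => Submodule.subset_span ⟨_, ?_, _, rfl⟩)
    (Submodule.sum_mem _ fun j _ => Submodule.subset_span ⟨_, ?_, _, rfl⟩)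
  · refine (Submodule.mem_bot _).2 (smul_right_injective A ht ?_)
    simp only [Finset.smul_sum, smul_zero, ← mul_smul_comm, ← he, Finset.mul_sum, ← mul_assoc]
    rw [Finset.sum_comm]
    simp [← Finset.sum_mul, ← Finset.smul_sum, hc]
  · exact (Submodule.mem_bot _).2 (hc j)

end Quotient

section Localization

open nonZeroDivisors

lemma smul_bijective_of_isLocalizedModule {R N N' : Type*} [CommRing R] [IsDomain R]
    [AddCommGroup N] [Module R N] [AddCommGroup N'] [Module R N'] (f : N →ₗ[R] N')
    [IsLocalizedModule R⁰ f] {r : R} (hr : r ≠ 0) : Function.Bijective fun x : N' => r • x :=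
  (Module.End.isUnit_iff _).1
    (IsLocalizedModule.map_units f ⟨r, mem_nonZeroDivisors_of_ne_zero hr⟩)

lemma exists_smul_eq_of_isLocalizedModule {R N N' : Type*} [CommRing R] [IsDomain R]
    [AddCommGroup N] [Module R N] [AddCommGroup N'] [Module R N'] (f : N →ₗ[R] N')
    [IsLocalizedModule R⁰ f] {ι : Type*} [Finite ι] (x : ι → N') :
    ∃ r : R, r ≠ 0 ∧ ∀ i, ∃ y, r • x i = f y := by
  obtain ⟨r, hr⟩ := IsLocalizedModule.exist_integer_multiples_of_finite R⁰ f x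
  exact ⟨r, nonZeroDivisors.coe_ne_zero r, fun i => (hr i).imp fun _ h => h.symm⟩

lemma injective_of_isLocalizedModule {R N N' : Type*} [CommRing R] [IsDomain R]
    [AddCommGroup N] [Module R N] [AddCommGroup N'] [Module R N'] (f : N →ₗ[R] N')
    [IsLocalizedModule R⁰ f] [Module.IsTorsionFree R N] : Function.Injective f := by
  intro x y h
  obtain ⟨c, hc⟩ := (IsLocalizedModule.eq_iff_exists R⁰ f).1 h
  exact smul_right_injective N (nonZeroDivisors.coe_ne_zero c) hc

lemma mem_relationsMod_of_smul_mem {I : Submodule Aᵐᵒᵖ A} {r : R}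
    (hr : Function.Bijective fun x : B => r • x) {n : ℕ} {a : Fin n → A} {b : Fin n → B}
    (hb : r • b ∈ relationsMod R B I a) : b ∈ relationsMod R B I a := by
  obtain ⟨m, c, y, hy, hc⟩ := (mem_relationsMod_iff R).1 hb
  choose z hz using fun j => hr.2 (y j)
  refine (mem_relationsMod_iff R).2 ⟨m, c, z, fun i => hr.1 ?_, hc⟩
  simpa [Finset.smul_sum, ← hz, smul_comm r] using hy i

lemma mem_rightIdealSMul_of_smul_mem {I : Submodule Aᵐᵒᵖ A} {r : R}
    (hr : Function.Bijective fun x : B => r • x) {b : B}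
    (hb : r • b ∈ rightIdealSMul R B I) : b ∈ rightIdealSMul R B I := by
  obtain ⟨m, a, y, ha, hy⟩ := (mem_rightIdealSMul_iff R).1 hb
  choose z hz using fun j => hr.2 (y j)
  refine (mem_rightIdealSMul_iff R).2 ⟨m, a, z, ha, hr.1 ?_⟩
  simpa [Finset.smul_sum, ← hz, smul_comm r] using hy

lemma mem_rightIdeal_of_smul_mem {I : Submodule Aᵐᵒᵖ A} {r : R}
    (hr : Function.Bijective fun a : A => r • a) {a : A} (ha : r • a ∈ I) : a ∈ I := by
  obtain ⟨u, hu : r • u = 1⟩ := hr.2 1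
  have : a = (r • a) * u := by rw [smul_mul_assoc, ← mul_smul_comm, hu, mul_one]
  rw [this]
  exact rightIdeal_mul_mem ha u

variable [IsDomain R] [IsLocalizedModule R⁰ φ.toLinearMap] [IsLocalizedModule R⁰ ψ]

omit [IsScalarTower R A B] in
lemma IsFlatMod.of_isLocalizedModule [Module.IsTorsionFree R B] (h : IsFlatMod A B)
    (hψ : ∀ a b, ψ (a • b) = φ a • ψ b) : IsFlatMod S M := by
  rw [isFlatMod_iff R]
  intro n s x hx
  obtain ⟨r, hr, hs⟩ := exists_smul_eq_of_isLocalizedModule φ.toLinearMap s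
  obtain ⟨t, ht, hx'⟩ := exists_smul_eq_of_isLocalizedModule ψ x
  choose a ha using hs
  choose b hb using hx'
  have ha' : ∀ i, φ (a i) = r • s i := fun i => (ha i).symm
  have h0 : ∑ i, a i • b i = 0 := by
    apply injective_of_isLocalizedModule ψ
    simp [hψ, ← hb, ha', smul_comm _ t, ← Finset.smul_sum, hx]
  obtain ⟨p, c, y, hy, hc⟩ := h n a b h0
  refine mem_relationsMod_of_smul_mem (smul_bijective_of_isLocalizedModule ψ ht)
    ((mem_relationsMod_iff R).2 ⟨p, fun i j => φ (c i j), fun j => ψ (y j), fun i => ?_,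
      fun j => (Submodule.mem_bot _).2
        ((smul_bijective_of_isLocalizedModule φ.toLinearMap hr).1 ?_)⟩)
  · simp [hb, hy, hψ]
  · simpa [ha', Finset.smul_sum] using congrArg φ (hc j)

lemma IsFaithfullyFlatMod.of_isLocalizedModule [Module.IsTorsionFree R B]
    (h : IsFaithfullyFlatMod A B) (hψ : ∀ a b, ψ (a • b) = φ a • ψ b) :
    IsFaithfullyFlatMod S M := by
  rw [isFaithfullyFlatMod_iff R] at h ⊢
  refine ⟨h.1.of_isLocalizedModule hψ, fun I hI => ?_⟩
  have htop : rightIdealSMul R B (rightIdealComap φ I) = ⊤ := by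
    refine eq_top_iff.2 fun b _ => ?_
    obtain ⟨p, s, x, hs, hx⟩ := (mem_rightIdealSMul_iff R).1 (hI ▸ Submodule.mem_top : ψ b ∈ _)
    obtain ⟨r, hr, hs'⟩ := exists_smul_eq_of_isLocalizedModule φ.toLinearMap s
    obtain ⟨t, ht, hx'⟩ := exists_smul_eq_of_isLocalizedModule ψ x
    choose a ha using hs'
    choose y hy using hx'
    have ha' : ∀ i, φ (a i) = r • s i := fun i => (ha i).symm
    have haI : ∀ i, a i ∈ rightIdealComap φ I := fun i => by
      rw [mem_rightIdealComap, ha']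
      exact rightIdeal_smul_mem R r (hs i)
    have hb : (r * t) • b = ∑ i, a i • y i := by
      apply injective_of_isLocalizedModule ψ
      simp [hψ, ← hy, ha', smul_comm _ t, ← Finset.smul_sum, hx, mul_smul]
    obtain ⟨q, c, z, hz, hc⟩ := (mem_relationsMod_iff R).1 <|
      h.1.mem_relationsMod R (rightIdealComap φ I) (n := 1) (a := fun _ => algebraMap R A (r * t))
        (b := fun _ => b) (by
          simpa [-map_mul, algebraMap_smul, hb] using
            (mem_rightIdealSMul_iff R).2 ⟨p, a, y, haI, rfl⟩)
    refine (mem_rightIdealSMul_iff R).2 ⟨q, c 0, z, fun j => ?_, hz 0⟩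
    refine mem_rightIdeal_of_smul_mem
      (smul_bijective_of_isLocalizedModule φ.toLinearMap (mul_ne_zero hr ht)) ?_
    simpa [-map_mul, ← Algebra.smul_def] using hc j
  have h1 : (1 : A) ∈ rightIdealComap φ I := by simp [h.2 _ htop]
  exact rightIdeal_eq_top_of_one_mem (by simpa using h1)

lemma exists_smul_mem_relationsMod_of_isLocalizedModule [Module.IsTorsionFree R A]
    [Module.IsTorsionFree R B] (h : IsFlatMod S M) (hψ : ∀ a b, ψ (a • b) = φ a • ψ b)
    {n : ℕ} {a : Fin n → A} {b : Fin n → B} (hab : ∑ i, a i • b i = 0) :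
    ∃ r : R, r ≠ 0 ∧ r • b ∈ relationsMod R B ⊥ a := by
  obtain ⟨p, d, x, hx, hd⟩ := h n (fun i => φ (a i)) (fun i => ψ (b i)) (by
    simpa [hψ] using congrArg ψ hab)
  obtain ⟨r, hr, hd'⟩ := exists_smul_eq_of_isLocalizedModule φ.toLinearMap
    fun ij : Fin n × Fin p => d ij.1 ij.2
  obtain ⟨t, ht, hx'⟩ := exists_smul_eq_of_isLocalizedModule ψ x
  choose c hc using hd'
  choose y hy using hx'
  have hc' : ∀ i j, φ (c (i, j)) = r • d i j := fun i j => (hc (i, j)).symm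
  refine ⟨r * t, mul_ne_zero hr ht, (mem_relationsMod_iff R).2
    ⟨p, fun i j => c (i, j), y, fun i => ?_, fun j => (Submodule.mem_bot _).2 ?_⟩⟩
  · apply injective_of_isLocalizedModule ψ
    simp [hψ, ← hy, hc', smul_comm _ t, ← Finset.smul_sum, hx, mul_smul]
  · apply injective_of_isLocalizedModule φ.toLinearMap
    simp [hc', ← Finset.smul_sum, hd]

omit [IsScalarTower R A B] in
lemma exists_smul_one_mem_of_isLocalizedModule [Module.IsTorsionFree R A]
    (hMS : ∀ I : Submodule Sᵐᵒᵖ S, rightIdealSMul R M I = ⊤ → I = ⊤)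
    (hψ : ∀ a b, ψ (a • b) = φ a • ψ b) {I : Submodule Aᵐᵒᵖ A}
    (hI : rightIdealSMul R B I = ⊤) : ∃ r : R, r ≠ 0 ∧ algebraMap R A r ∈ I := by
  let J : Submodule Sᵐᵒᵖ S :=
    { carrier := {s | ∃ r : R, r ≠ 0 ∧ ∃ a ∈ I, r • s = φ a}
      add_mem' := by
        rintro s s' ⟨r, hr, a, ha, h⟩ ⟨r', hr', a', ha', h'⟩
        refine ⟨r * r', mul_ne_zero hr hr', r' • a + r • a', I.add_mem
          (rightIdeal_smul_mem R _ ha) (rightIdeal_smul_mem R _ ha'), ?_⟩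
        rw [map_add, map_smul, map_smul, ← h, ← h', smul_add, mul_smul, mul_smul, smul_comm r r']
      zero_mem' := ⟨1, one_ne_zero, 0, I.zero_mem, by simp⟩
      smul_mem' := by
        rintro s s' ⟨r, hr, a, ha, h⟩
        obtain ⟨r', hr', h'⟩ := exists_smul_eq_of_isLocalizedModule φ.toLinearMap
          fun _ : Unit => s.unop
        obtain ⟨a', h'⟩ := h' ()
        refine ⟨r * r', mul_ne_zero hr hr', a * a', rightIdeal_mul_mem ha a', ?_⟩
        have h'' : r' • s.unop = φ a' := h'
        rw [map_mul, ← h, ← h'', MulOpposite.smul_eq_mul_unop, smul_mul_smul_comm] }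
  have hle : (rightIdealSMul R B I).map ψ ≤ rightIdealSMul R M J := by
    rw [Submodule.map_le_iff_le_comap]
    refine Submodule.span_le.2 ?_
    rintro _ ⟨a, ha, y, rfl⟩
    simp only [Submodule.comap_coe, Set.mem_preimage, hψ]
    exact smul_mem_rightIdealSMul R (I := J) ⟨1, one_ne_zero, a, ha, one_smul _ _⟩ _
  have hJ : J = ⊤ := by
    refine hMS J (eq_top_iff.2 fun x _ => ?_)
    obtain ⟨r, hr, hx⟩ := exists_smul_eq_of_isLocalizedModule ψ fun _ : Unit => x
    obtain ⟨b, hb⟩ := hx ()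
    refine mem_rightIdealSMul_of_smul_mem (smul_bijective_of_isLocalizedModule ψ hr) ?_
    rw [hb]
    exact hle ⟨b, hI ▸ Submodule.mem_top, rfl⟩
  obtain ⟨r, hr, a, ha, h⟩ : (1 : S) ∈ J := hJ ▸ Submodule.mem_top
  have : algebraMap R A r = a := by
    apply injective_of_isLocalizedModule φ.toLinearMap
    simp [← h, Algebra.algebraMap_eq_smul_one]
  exact ⟨r, hr, this ▸ ha⟩

end Localization

end BaseChange
section Dedekind

variable {R : Type*} [CommRing R] [IsDedekindDomain R]

lemma Ideal.eq_top_of_forall_isMaximal_mul {J : Ideal R} (hJ : J ≠ ⊥)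
    (h : ∀ m : Ideal R, m.IsMaximal → m ≠ ⊥ → ∀ J' : Ideal R, J = m * J' → J' ≤ J) : J = ⊤ := by
  by_contra hne
  obtain ⟨m, hm, hle⟩ := J.exists_le_maximal hne
  obtain ⟨J', hJ'⟩ := Ideal.dvd_iff_le.2 hle
  have hm0 : m ≠ ⊥ := fun h0 => hJ (le_bot_iff.1 (h0 ▸ hle))
  have heq : J' = J := le_antisymm (h m hm hm0 J' hJ') (hJ' ▸ Ideal.mul_le_right)
  rw [heq] at hJ'
  have h1 : m * J = 1 * J := by rw [one_mul, ← hJ']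
  exact hm.ne_top ((mul_right_cancel₀ hJ h1).trans Ideal.one_eq_top)

/-- A nonzero maximal ideal of a Dedekind domain is locally generated by one element. -/
lemma Ideal.IsMaximal.exists_local_generator {m : Ideal R} (hm : m.IsMaximal) (hm0 : m ≠ ⊥) :
    ∃ t ∈ m, t ≠ 0 ∧ ∃ s ∉ m, ∀ x ∈ m, t ∣ s * x := by
  obtain ⟨t, ht, ht2⟩ := Ideal.exists_mem_pow_notMem_pow_succ m hm0 hm.ne_top 1
  rw [pow_one] at ht
  obtain ⟨I, hI⟩ := Ideal.dvd_iff_le.2 ((Ideal.span_singleton_le_iff_mem m).2 ht)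
  have hIm : ¬ I ≤ m := fun hle => ht2 <| by
    rw [pow_succ, pow_one]
    exact Ideal.mul_mono_right hle (hI ▸ Ideal.mem_span_singleton_self t)
  obtain ⟨s, hsI, hsm⟩ := SetLike.not_le_iff_exists.1 hIm
  refine ⟨t, ht, fun h0 => ht2 (h0 ▸ zero_mem _), s, hsm, fun x hx => ?_⟩
  rw [← Ideal.mem_span_singleton, hI, mul_comm s]
  exact Ideal.mul_mem_mul hx hsI

end Dedekind

section Fiber

variable (R A B k : Type*) [CommRing R] [Ring A] [Algebra R A]
  [AddCommGroup B] [Module R B] [Module A B] [IsScalarTower R A B]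
  [CommRing k] [Algebra R k]

attribute [local instance] fiberModule

lemma fiberModule_tmul_smul_tmul (a : A) (c : k) (b : B) (d : k) :
    (a ⊗ₜ[R] c) • (b ⊗ₜ[R] d) = (a • b) ⊗ₜ[R] (c * d) := rfl

lemma fiberModule_isScalarTower : IsScalarTower R (A ⊗[R] k) (B ⊗[R] k) := by
  constructor
  intro r s x
  induction s with
  | zero => simp
  | add s s' hs hs' => simp only [smul_add, add_smul, hs, hs']
  | tmul a c =>
    induction x with
    | zero => simp
    | add x y hx hy => simp only [smul_add, hx, hy]
    | tmul b d =>
      rw [smul_tmul', fiberModule_tmul_smul_tmul, fiberModule_tmul_smul_tmul, smul_tmul',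
        smul_assoc]

lemma mk_flip_one_smul (a : A) (b : B) : (TensorProduct.mk R B k).flip 1 (a • b) =
    (Algebra.TensorProduct.includeLeft (R := R) (S := R) (A := A) (B := k) a) •
      (TensorProduct.mk R B k).flip 1 b := by
  simp [fiberModule_tmul_smul_tmul]

end Fiber

section FiberMaps

variable {R : Type*} [CommRing R]

lemma isLocalizedModule_mk_flip_one (S : Submonoid R) (k N : Type*) [CommRing k] [Algebra R k]
    [IsLocalization S k] [AddCommGroup N] [Module R N] :
    IsLocalizedModule S ((TensorProduct.mk R N k).flip 1) :=
  IsLocalizedModule.of_linearEquiv S (TensorProduct.mk R k N 1) (TensorProduct.comm R k N)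

lemma mk_flip_one_surjective (m : Ideal R) (N : Type*) [AddCommGroup N] [Module R N] :
    Function.Surjective ((TensorProduct.mk R N (R ⧸ m)).flip 1) := by
  intro x
  obtain ⟨y, hy⟩ := Submodule.Quotient.mk_surjective _ (tensorQuotEquivQuotSMul N m x)
  exact ⟨y, (tensorQuotEquivQuotSMul_symm_mk m y).symm.trans (by rw [hy]; simp)⟩

lemma mem_smul_top_of_mk_flip_one_eq_zero (m : Ideal R) {N : Type*} [AddCommGroup N] [Module R N]
    {x : N} (hx : (TensorProduct.mk R N (R ⧸ m)).flip 1 x = 0) :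
    x ∈ m • (⊤ : Submodule R N) := by
  rw [← Submodule.Quotient.mk_eq_zero, ← (tensorQuotEquivQuotSMul N m).symm.map_eq_zero_iff,
    tensorQuotEquivQuotSMul_symm_mk]
  exact hx

end FiberMaps

/-- **Proposition (faithful flatness criterion over a Dedekind domain).**
Let `R` be a Dedekind domain with fraction field `K`, `A` an associative unital
`R`-algebra and `B` a left `A`-module, with both `A` and `B` flat over `R`.
Then `B` is faithfully flat as a left `A`-module iff `B ⊗[R] k` is faithfully flat
as a left `(A ⊗[R] k)`-module for `k = K` and for `k = R/m`, `m` any maximal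
ideal of `R`. -/
theorem faithfullyFlat_iff_faithfullyFlat_fibers
    (R : Type*) [CommRing R] [IsDomain R] [IsDedekindDomain R]
    (A : Type*) [Ring A] [Algebra R A]
    (B : Type*) [AddCommGroup B] [Module R B] [Module A B] [IsScalarTower R A B]
    [Module.Flat R A] [Module.Flat R B] :
    IsFaithfullyFlatMod A B ↔
      ((letI := fiberModule R A B (FractionRing R);
        IsFaithfullyFlatMod (A ⊗[R] FractionRing R) (B ⊗[R] FractionRing R)) ∧
        ∀ m : Ideal R, m.IsMaximal →
          letI := fiberModule R A B (R ⧸ m);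
          IsFaithfullyFlatMod (A ⊗[R] (R ⧸ m)) (B ⊗[R] (R ⧸ m))) := by
  have hA : ∀ (m : Ideal R), ∀ r ∈ m, algebraMap R (A ⊗[R] (R ⧸ m)) r = 0 := fun m r hr => by
    rw [Algebra.algebraMap_eq_smul_one, Algebra.TensorProduct.one_def, smul_tmul', smul_tmul,
      ← Algebra.algebraMap_eq_smul_one, Ideal.Quotient.algebraMap_eq,
      Ideal.Quotient.eq_zero_iff_mem.2 hr, tmul_zero]
  let := fiberModule R A B (FractionRing R)
  let := fun m : Ideal R => fiberModule R A B (R ⧸ m)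
  have := fiberModule_isScalarTower R A B (FractionRing R)
  have := fun m : Ideal R => fiberModule_isScalarTower R A B (R ⧸ m)
  have : IsLocalizedModule (nonZeroDivisors R) (Algebra.TensorProduct.includeLeft
      (R := R) (S := R) (A := A) (B := FractionRing R)).toLinearMap :=
    isLocalizedModule_mk_flip_one _ _ A
  have := isLocalizedModule_mk_flip_one (nonZeroDivisors R) (FractionRing R) B
  constructor
  · intro h
    exact ⟨h.of_isLocalizedModule (mk_flip_one_smul R A B (FractionRing R)), fun m _ =>
      h.of_quotient (mk_flip_one_smul R A B (R ⧸ m)) (mk_flip_one_surjective m A)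
        (mk_flip_one_surjective m B) (hA m) fun b => mem_smul_top_of_mk_flip_one_eq_zero m⟩
  · rintro ⟨hK, hk⟩
    rw [isFaithfullyFlatMod_iff R] at hK ⊢
    refine ⟨(isFlatMod_iff R).2 fun n a b hab => ?_, fun I hI => ?_⟩
    · obtain ⟨r, hr, hrb⟩ := exists_smul_mem_relationsMod_of_isLocalizedModule hK.1
        (mk_flip_one_smul R A B (FractionRing R)) hab
      let J : Ideal R := (relationsMod R B ⊥ a).comap (LinearMap.toSpanSingleton R _ b)
      have hJ : J = ⊤ := by
        refine Ideal.eq_top_of_forall_isMaximal_mul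
          (fun h0 => hr ((Submodule.mem_bot R).1 (h0 ▸ (show r ∈ J from hrb))))
          fun m hm hm0 J' hJ' x hx => ?_
        have hmul : ∀ y ∈ m, y * x ∈ J := fun y hy => hJ' ▸ Ideal.mul_mem_mul hy hx
        obtain ⟨t, htm, ht, s, hs, hst⟩ := hm.exists_local_generator hm0
        have hsx : s • x • b ∈ relationsMod R B ⊥ a :=
          smul_mem_relationsMod_of_quotient (hk m hm).1 (mk_flip_one_smul R A B (R ⧸ m))
            (mk_flip_one_surjective m A) (mk_flip_one_surjective m B) (hA m)
            (fun a => mem_smul_top_of_mk_flip_one_eq_zero m)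
            (fun b => mem_smul_top_of_mk_flip_one_eq_zero m) htm ht hst
            (by rw [smul_smul]; exact hmul t htm)
        rw [smul_smul] at hsx
        obtain ⟨y, i, hi, hyi⟩ := hm.exists_inv hs
        have : x = y * (s * x) + i * x := by rw [← mul_assoc, ← add_mul, hyi, one_mul]
        rw [this]
        exact J.add_mem (J.mul_mem_left y hsx) (hmul i hi)
      simpa [J] using (hJ ▸ Submodule.mem_top : (1 : R) ∈ J)
    · obtain ⟨r, hr, hrI⟩ := exists_smul_one_mem_of_isLocalizedModule hK.2
        (mk_flip_one_smul R A B (FractionRing R)) hI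
      let J : Ideal R :=
        { carrier := {x | algebraMap R A x ∈ I}
          add_mem' := fun hx hy => by simpa using I.add_mem hx hy
          zero_mem' := by simp
          smul_mem' := fun c x hx => by
            simpa [Algebra.smul_def] using rightIdeal_smul_mem R c hx }
      have hJ : J = ⊤ := by
        refine Ideal.eq_top_of_forall_isMaximal_mul
          (fun h0 => hr ((Submodule.mem_bot R).1 (h0 ▸ (show r ∈ J from hrI))))
          fun m hm _ J' hJ' x hx => ?_
        obtain ⟨a, ha, ha1⟩ := exists_mem_sub_mem_smul_top ((isFaithfullyFlatMod_iff R).1 (hk m hm)).2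
          (mk_flip_one_smul R A B (R ⧸ m)) (mk_flip_one_surjective m A)
          (mk_flip_one_surjective m B) (fun a => mem_smul_top_of_mk_flip_one_eq_zero m) hI
        have hsub : ∀ z ∈ m • (⊤ : Submodule R A), x • z ∈ I := fun z hz => by
          induction hz using Submodule.smul_induction_on' with
          | smul y hy z _ =>
            have : algebraMap R A (y * x) ∈ I :=
              show y * x ∈ J from hJ' ▸ Ideal.mul_mem_mul hy hx
            rw [smul_smul, mul_comm, Algebra.smul_def]
            exact rightIdeal_mul_mem this z
          | add z _ w _ hz hw => rw [smul_add]; exact I.add_mem hz hw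
        show algebraMap R A x ∈ I
        rw [Algebra.algebraMap_eq_smul_one, ← sub_add_cancel 1 a, smul_add]
        exact I.add_mem (hsub _ ha1) (rightIdeal_smul_mem R x ha)
      have h1 : (1 : R) ∈ J := hJ ▸ Submodule.mem_top
      exact rightIdeal_eq_top_of_one_mem (by simpa [J] using h1)
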